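/- For every a ∈ Γ and every z ∈ K, the function h_a(z) defined by h_a(z) = (z·f_i) e^{a·z} − 𝔼_z[(f_i·S(τ)) e^{a·S(τ)}; τ < ∞] if q(a) = c_i (i = 1,2), and h_a(z) = e^{a·z} − 𝔼_z[e^{a·S(τ)}; τ < ∞] if q(a) lies in the interior of Σ, is strictly positive on K and harmonic for the random walk killed when leaving the cone K (i.e. 𝔼_z[h_a(S(1)); τ > 1] = h_a(z) for all z ∈ K). -/

import Mathlib

open scoped ENNReal Classical

noncomputable section

namespace KilledRW

/-- The two-dimensional integer lattice. -/
abbrev Z2 := ℤ × ℤ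

/-- The plane `ℝ²`. -/
abbrev R2 := ℝ × ℝ

/-- Euclidean dot product on `ℝ²`. -/
def dotR (a b : R2) : ℝ := a.1 * b.1 + a.2 * b.2

/-- Embedding of the lattice into the plane. -/
def emb (z : Z2) : R2 := ((z.1 : ℝ), (z.2 : ℝ))

/-- Euclidean norm on `ℝ²`. -/
def nrm (x : R2) : ℝ := Real.sqrt (dotR x x)

/-- The jump generating function `φ(a) = Σ_z γ(z) e^{a·z}`. -/
def jgf (γ : Z2 → ℝ) (a : R2) : ℝ := ∑' z : Z2, γ z * Real.exp (dotR a (emb z))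

/-- The gradient `∇φ(a) = Σ_z z γ(z) e^{a·z}` of the jump generating function. -/
def gradJgf (γ : Z2 → ℝ) (a : R2) : R2 :=
  (∑' z : Z2, γ z * Real.exp (dotR a (emb z)) * (z.1 : ℝ),
   ∑' z : Z2, γ z * Real.exp (dotR a (emb z)) * (z.2 : ℝ))

/-- The normalized gradient `q(a) = ∇φ(a)/|∇φ(a)|`. -/
def qmap (γ : Z2 → ℝ) (a : R2) : R2 := (nrm (gradJgf γ a))⁻¹ • gradJgf γ a

/-- (Sub)stochastic transition kernel of the twisted random walk `S_a`:
`p_a(z,z') = γ(z'-z) e^{a·(z'-z)}`.  For `a = 0` this is the kernel of the original walk. -/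
def twKer (γ : Z2 → ℝ) (a : R2) (z z' : Z2) : ℝ≥0∞ :=
  ENNReal.ofReal (γ (z' - z) * Real.exp (dotR a (emb (z' - z))))

/-- `n`-step transition probabilities of the (sub)stochastic kernel `κ`. -/
def nstep (κ : Z2 → Z2 → ℝ≥0∞) : ℕ → Z2 → Z2 → ℝ≥0∞
  | 0, z, z' => if z' = z then 1 else 0
  | n + 1, z, z' => ∑' w : Z2, κ z w * nstep κ n w z'

/-- `exitP κ A n z z' = ℙ_z(τ_A = n, S(n) = z')`: the probability that the walk with kernel `κ`
started at `z` stays in `A` strictly before time `n` and is at `z' ∉ A` at time `n`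
(where `τ_A = inf{n ≥ 0 : S(n) ∉ A}`). -/
def exitP (κ : Z2 → Z2 → ℝ≥0∞) (A : Set Z2) : ℕ → Z2 → Z2 → ℝ≥0∞
  | 0, z, z' => if z' = z ∧ z ∉ A then 1 else 0
  | n + 1, z, z' => if z ∈ A then ∑' w : Z2, κ z w * exitP κ A n w z' else 0

/-- `aliveP κ A n z z' = ℙ_z(τ_A > n, S(n) = z')`. -/
def aliveP (κ : Z2 → Z2 → ℝ≥0∞) (A : Set Z2) : ℕ → Z2 → Z2 → ℝ≥0∞
  | 0, z, z' => if z' = z ∧ z ∈ A then 1 else 0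
  | n + 1, z, z' => if z ∈ A then ∑' w : Z2, κ z w * aliveP κ A n w z' else 0

/-- `ℙ_z(τ_A < ∞)` for the walk with kernel `κ`. -/
def exitTotal (κ : Z2 → Z2 → ℝ≥0∞) (A : Set Z2) (z : Z2) : ℝ≥0∞ :=
  ∑' n : ℕ, ∑' z' : Z2, exitP κ A n z z'

/-- `𝔼_z[g(S(τ_A)); τ_A < ∞]` for a nonnegative integrand, with values in `ℝ≥0∞`. -/
def exitLExp (κ : Z2 → Z2 → ℝ≥0∞) (A : Set Z2) (z : Z2) (g : Z2 → ℝ) : ℝ≥0∞ :=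
  ∑' n : ℕ, ∑' z' : Z2, exitP κ A n z z' * ENNReal.ofReal (g z')

/-- `𝔼_z[g(S(τ_A)); τ_A < ∞]` for a signed integrand (positive part minus negative part). -/
def exitExp (κ : Z2 → Z2 → ℝ≥0∞) (A : Set Z2) (z : Z2) (g : Z2 → ℝ) : ℝ :=
  (exitLExp κ A z g).toReal - (exitLExp κ A z fun w => -g w).toReal

/-- `𝔼_z[g(S(τ_A)); τ_A ≤ n]`, nonnegative version. -/
def exitLExpTrunc (κ : Z2 → Z2 → ℝ≥0∞) (A : Set Z2) (z : Z2) (g : Z2 → ℝ) (n : ℕ) : ℝ≥0∞ :=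
  ∑ m ∈ Finset.range (n + 1), ∑' z' : Z2, exitP κ A m z z' * ENNReal.ofReal (g z')

/-- `𝔼_z[g(S(τ_A)); τ_A ≤ n]`, signed version. -/
def exitExpTrunc (κ : Z2 → Z2 → ℝ≥0∞) (A : Set Z2) (z : Z2) (g : Z2 → ℝ) (n : ℕ) : ℝ :=
  (exitLExpTrunc κ A z g n).toReal - (exitLExpTrunc κ A z (fun w => -g w) n).toReal

/-- `𝔼_z[g(S(n)); τ_A > n]`, nonnegative version. -/
def aliveLExpAt (κ : Z2 → Z2 → ℝ≥0∞) (A : Set Z2) (z : Z2) (g : Z2 → ℝ) (n : ℕ) : ℝ≥0∞ :=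
  ∑' z' : Z2, aliveP κ A n z z' * ENNReal.ofReal (g z')

/-- `𝔼_z[g(S(n)); τ_A > n]`, signed version. -/
def aliveExpAt (κ : Z2 → Z2 → ℝ≥0∞) (A : Set Z2) (z : Z2) (g : Z2 → ℝ) (n : ℕ) : ℝ :=
  (aliveLExpAt κ A z g n).toReal - (aliveLExpAt κ A z (fun w => -g w) n).toReal

section

variable {κ : Z2 → Z2 → ℝ≥0∞} {A : Set Z2} {γ : Z2 → ℝ}

/-- The optional stopping inequality for a nonnegative superharmonic function. -/
lemma tsum_exitP_mul_le {U : Z2 → ℝ≥0∞} (hU : ∀ z ∈ A, ∑' w, κ z w * U w ≤ U z) (z : Z2) :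
    ∑' n, ∑' z', exitP κ A n z z' * U z' ≤ U z := by
  refine ENNReal.tsum_le_of_sum_range_le fun N => ?_
  induction N generalizing z with
  | zero => simp
  | succ N ih =>
    rw [Finset.sum_range_succ']
    by_cases hz : z ∈ A
    · have h0 : ∑' z', exitP κ A 0 z z' * U z' = 0 := by simp [exitP, hz]
      rw [h0, add_zero]
      have h1 : ∀ n, ∑' z', exitP κ A (n + 1) z z' * U z'
          = ∑' w, κ z w * ∑' z', exitP κ A n w z' * U z' := by
        intro n
        simp only [exitP, hz, if_true, ← ENNReal.tsum_mul_right, ← ENNReal.tsum_mul_left,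
          mul_assoc]
        exact ENNReal.tsum_comm
      simp only [h1]
      rw [← Summable.tsum_finsetSum fun _ _ => ENNReal.summable]
      refine le_trans (ENNReal.tsum_le_tsum fun w => ?_) (hU z hz)
      rw [← Finset.mul_sum]
      gcongr
      exact ih w
    · simp [exitP, hz]

lemma exitLExp_of_notMem {z : Z2} (hz : z ∉ A) (g : Z2 → ℝ) :
    exitLExp κ A z g = ENNReal.ofReal (g z) := by
  rw [exitLExp, tsum_eq_single 0]
  · simp [exitP, hz]
  · rintro (_ | n) hn
    · exact absurd rfl hn
    · simp [exitP, hz]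

lemma exitLExp_of_mem {z : Z2} (hz : z ∈ A) (g : Z2 → ℝ) :
    exitLExp κ A z g = ∑' w, κ z w * exitLExp κ A w g := by
  rw [exitLExp, tsum_eq_zero_add' ENNReal.summable]
  have h0 : ∑' z', exitP κ A 0 z z' * ENNReal.ofReal (g z') = 0 := by simp [exitP, hz]
  have h1 : ∀ n, ∑' z', exitP κ A (n + 1) z z' * ENNReal.ofReal (g z')
      = ∑' w, κ z w * ∑' z', exitP κ A n w z' * ENNReal.ofReal (g z') := by
    intro n
    simp only [exitP, hz, if_true, ← ENNReal.tsum_mul_right, ← ENNReal.tsum_mul_left, mul_assoc]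
    exact ENNReal.tsum_comm
  simp only [h0, h1, zero_add, exitLExp]
  rw [ENNReal.tsum_comm]
  simp only [ENNReal.tsum_mul_left]

lemma exitP_eq_zero_of_mem {z' : Z2} (hz' : z' ∈ A) (n : ℕ) (z : Z2) :
    exitP κ A n z z' = 0 := by
  induction n generalizing z with
  | zero =>
    simp only [exitP, ite_eq_right_iff, one_ne_zero, imp_false, not_and, not_not]
    rintro rfl
    exact hz'
  | succ n ih => simp [exitP, ih]

lemma exitLExp_mono {g g' : Z2 → ℝ} (h : ∀ w ∉ A, g w ≤ g' w) (z : Z2) :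
    exitLExp κ A z g ≤ exitLExp κ A z g' := by
  refine ENNReal.tsum_le_tsum fun n => ENNReal.tsum_le_tsum fun w => ?_
  by_cases hw : w ∈ A
  · simp [exitP_eq_zero_of_mem hw]
  · gcongr
    exact h w hw

lemma twKer_zero (γ : Z2 → ℝ) (z w : Z2) : twKer γ 0 z w = ENNReal.ofReal (γ (w - z)) := by
  simp [twKer, dotR]

lemma tsum_twKer_mul_ofReal (hγ0 : ∀ z, 0 ≤ γ z) {U : Z2 → ℝ} (hU : ∀ w, 0 ≤ U w) {z : Z2}
    {s : ℝ} (hs : HasSum (fun w => γ (w - z) * U w) s) :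
    ∑' w, twKer γ 0 z w * ENNReal.ofReal (U w) = ENNReal.ofReal s := by
  rw [← hs.tsum_eq, ENNReal.ofReal_tsum_of_nonneg (fun w => mul_nonneg (hγ0 _) (hU w)) hs.summable]
  exact tsum_congr fun w => by rw [twKer_zero, ENNReal.ofReal_mul (hγ0 _)]

/-- Exit expectations are dominated by nonnegative functions superharmonic on `A`. -/
lemma exitLExp_le_of_superharmonic (hγ0 : ∀ z, 0 ≤ γ z) {U g : Z2 → ℝ} (hU : ∀ w, 0 ≤ U w)
    (hsup : ∀ z ∈ A, ∃ s ≤ U z, HasSum (fun w => γ (w - z) * U w) s)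
    (hg : ∀ w ∉ A, g w ≤ U w) (z : Z2) :
    exitLExp (twKer γ 0) A z g ≤ ENNReal.ofReal (U z) := by
  refine (exitLExp_mono hg z).trans (tsum_exitP_mul_le (fun z hz => ?_) z)
  obtain ⟨s, hs, hsum⟩ := hsup z hz
  rw [tsum_twKer_mul_ofReal hγ0 hU hsum]
  exact ENNReal.ofReal_le_ofReal hs

lemma hasSum_exitLExp_toReal (hγ0 : ∀ z, 0 ≤ γ z) {g : Z2 → ℝ}
    (hfin : ∀ z, exitLExp (twKer γ 0) A z g ≠ ⊤) {z : Z2} (hz : z ∈ A) :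
    HasSum (fun w => γ (w - z) * (exitLExp (twKer γ 0) A w g).toReal)
      (exitLExp (twKer γ 0) A z g).toReal := by
  have key := exitLExp_of_mem (κ := twKer γ 0) hz g
  have hne := key ▸ hfin z
  have h := ENNReal.hasSum_toReal hne
  rw [← ENNReal.tsum_toReal_eq (ENNReal.ne_top_of_tsum_ne_top hne), ← key] at h
  simpa [twKer_zero, ENNReal.toReal_mul, ENNReal.toReal_ofReal (hγ0 _)] using h

/-- Subtracting its exit expectation from a function `g` harmonic and nonnegative on `A` yields
a nonnegative function, harmonic for the walk killed when leaving `A`. -/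
lemma sub_exitExp_harmonic (hγ0 : ∀ z, 0 ≤ γ z) {g : Z2 → ℝ}
    (hg : ∀ z, HasSum (fun w => γ (w - z) * g w) (g z)) (hgA : ∀ z ∈ A, 0 ≤ g z)
    (hfin : ∀ z, exitLExp (twKer γ 0) A z (fun w => |g w|) ≠ ⊤) :
    (∀ z, 0 ≤ g z - exitExp (twKer γ 0) A z g) ∧
    (∀ z ∉ A, g z - exitExp (twKer γ 0) A z g = 0) ∧
    ∀ z ∈ A, HasSum (fun w => γ (w - z) * (g w - exitExp (twKer γ 0) A w g))
      (g z - exitExp (twKer γ 0) A z g) := by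
  have hp : ∀ z, exitLExp (twKer γ 0) A z g ≠ ⊤ := fun z =>
    ne_top_of_le_ne_top (hfin z) (exitLExp_mono (fun w _ => le_abs_self _) z)
  have hn : ∀ z, exitLExp (twKer γ 0) A z (fun w => -g w) ≠ ⊤ := fun z =>
    ne_top_of_le_ne_top (hfin z) (exitLExp_mono (fun w _ => neg_le_abs _) z)
  have hout : ∀ z ∉ A, g z - exitExp (twKer γ 0) A z g = 0 := by
    intro z hz
    rw [exitExp, exitLExp_of_notMem hz, exitLExp_of_notMem hz, ENNReal.toReal_ofReal',
      ENNReal.toReal_ofReal']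
    rcases le_total 0 (g z) with h | h <;> simp [h]
  have hle : ∀ z, exitLExp (twKer γ 0) A z g
      ≤ ENNReal.ofReal (g z + (exitLExp (twKer γ 0) A z (fun w => -g w)).toReal) := by
    have hoff : ∀ w ∉ A, g w + (exitLExp (twKer γ 0) A w (fun w => -g w)).toReal
        = max (g w) 0 := by
      intro w hw
      rw [exitLExp_of_notMem hw, ENNReal.toReal_ofReal']
      rcases le_total 0 (g w) with h | h <;> simp [h]
    refine exitLExp_le_of_superharmonic hγ0 (fun w => ?_) (fun z hz => ⟨_, le_rfl, ?_⟩)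
      fun w hw => ?_
    · by_cases hw : w ∈ A
      · exact add_nonneg (hgA w hw) ENNReal.toReal_nonneg
      · rw [hoff w hw]
        exact le_max_right _ _
    · simpa only [mul_add] using (hg z).add (hasSum_exitLExp_toReal hγ0 hn hz)
    · rw [hoff w hw]
      exact le_max_left _ _
  refine ⟨fun z => ?_, hout, fun z hz => ?_⟩
  · by_cases hz : z ∈ A
    · have := ENNReal.toReal_le_of_le_ofReal
        (add_nonneg (hgA z hz) ENNReal.toReal_nonneg) (hle z)
      rw [exitExp]
      linarith
    · exact (hout z hz).ge
  · simpa only [mul_sub, exitExp] using (hg z).sub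
      ((hasSum_exitLExp_toReal hγ0 hp hz).sub (hasSum_exitLExp_toReal hγ0 hn hz))

/-- Positivity of a nonnegative harmonic function propagates along paths of the killed walk. -/
lemma pos_of_aliveP_pos (hγ0 : ∀ z, 0 ≤ γ z) {H : Z2 → ℝ} (hH : ∀ z, 0 ≤ H z)
    (hsum : ∀ z ∈ A, HasSum (fun w => γ (w - z) * H w) (H z)) {z' : Z2} (hz' : 0 < H z')
    (n : ℕ) (z : Z2) (h : 0 < aliveP (twKer γ 0) A n z z') : 0 < H z := by
  induction n generalizing z with
  | zero =>
    simp only [aliveP] at h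
    split_ifs at h with h1
    · exact h1.1 ▸ hz'
    · exact absurd h (lt_irrefl _)
  | succ n ih =>
    simp only [aliveP] at h
    split_ifs at h with h1
    · obtain ⟨w, hw⟩ : ∃ w, twKer γ 0 z w * aliveP (twKer γ 0) A n w z' ≠ 0 := by
        by_contra! hc
        simp [hc] at h
      rw [mul_ne_zero_iff, twKer_zero] at hw
      have hk : 0 < γ (w - z) := by
        simpa using hw.1
      calc 0 < γ (w - z) * H w := mul_pos hk (ih w (pos_iff_ne_zero.2 hw.2))
        _ ≤ H z := le_hasSum (hsum z h1) w fun v _ => mul_nonneg (hγ0 _) (hH v)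
    · exact absurd h (lt_irrefl _)

/-- The combined conclusion: if moreover `g` exceeds its exit expectation at one point of an
irreducible domain, the resulting harmonic function is strictly positive. -/
lemma sub_exitExp_pos_harmonic (hγ0 : ∀ z, 0 ≤ γ z)
    (hirr : ∀ z z', z ∈ A → z' ∈ A → ∃ n, 0 < aliveP (twKer γ 0) A n z z') {g : Z2 → ℝ}
    (hg : ∀ z, HasSum (fun w => γ (w - z) * g w) (g z)) (hgA : ∀ z ∈ A, 0 ≤ g z)
    (hfin : ∀ z, exitLExp (twKer γ 0) A z (fun w => |g w|) ≠ ⊤)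
    {w : Z2} (hw : w ∈ A) (hlt : exitLExp (twKer γ 0) A w g < ENNReal.ofReal (g w))
    {z : Z2} (hz : z ∈ A) :
    0 < g z - exitExp (twKer γ 0) A z g ∧
    (∑' z', if z' ∈ A then γ (z' - z) * (g z' - exitExp (twKer γ 0) A z' g) else 0)
      = g z - exitExp (twKer γ 0) A z g := by
  obtain ⟨h0, hout, hsum⟩ := sub_exitExp_harmonic hγ0 hg hgA hfin
  constructor
  · obtain ⟨n, hn⟩ := hirr z w hz hw
    refine pos_of_aliveP_pos hγ0 (H := fun z => g z - exitExp (twKer γ 0) A z g) h0 hsum ?_ n z hn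
    have h1 := ENNReal.toReal_lt_of_lt_ofReal hlt
    have h2 : 0 ≤ (exitLExp (twKer γ 0) A w (fun w => -g w)).toReal := ENNReal.toReal_nonneg
    simp only [exitExp]
    linarith
  · rw [← (hsum z hz).tsum_eq]
    refine tsum_congr fun w => ?_
    split_ifs with hw
    · rfl
    · rw [hout w hw, mul_zero]

lemma dotR_add_left (a b x : R2) : dotR (a + b) x = dotR a x + dotR b x := by
  simp [dotR]; ring

lemma dotR_smul_left (t : ℝ) (a x : R2) : dotR (t • a) x = t * dotR a x := by
  simp [dotR]; ring

lemma dotR_smul_right (t : ℝ) (a x : R2) : dotR a (t • x) = t * dotR a x := by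
  simp [dotR]; ring

lemma dotR_emb_add (a : R2) (z w : Z2) : dotR a (emb (z + w)) = dotR a (emb z) + dotR a (emb w) := by
  simp [dotR, emb]; ring

lemma emb_nsmul (n : ℕ) (z : Z2) : emb (n • z) = (n : ℝ) • emb z := by
  simp [emb]

lemma hasSum_of_eq {F G : Z2 → ℝ} {s t : ℝ} (h : HasSum F s) (hFG : ∀ w, G w = F w)
    (hst : t = s) : HasSum G t := by
  rwa [hst, funext hFG]

lemma hasSum_jgf (hA3 : ∀ a : R2, Summable fun z : Z2 => γ z * Real.exp (dotR a (emb z)))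
    (a : R2) : HasSum (fun z : Z2 => γ z * Real.exp (dotR a (emb z))) (jgf γ a) :=
  (hA3 a).hasSum

lemma hasSum_translate_iff {G : Z2 → ℝ} {z : Z2} {s : ℝ} :
    HasSum (fun w => γ (w - z) * G w) s ↔ HasSum (fun x => γ x * G (x + z)) s := by
  rw [← (Equiv.addRight z).hasSum_iff]
  simp [Function.comp_def]

lemma hasSum_exp (hA3 : ∀ a : R2, Summable fun z : Z2 => γ z * Real.exp (dotR a (emb z)))
    (a : R2) (z : Z2) :
    HasSum (fun w => γ (w - z) * Real.exp (dotR a (emb w)))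
      (jgf γ a * Real.exp (dotR a (emb z))) := by
  rw [hasSum_translate_iff]
  simpa only [dotR_emb_add, Real.exp_add, mul_assoc] using
    (hasSum_jgf hA3 a).mul_right (Real.exp (dotR a (emb z)))

lemma summable_mul_coord (hγ0 : ∀ z, 0 ≤ γ z)
    (hA3 : ∀ a : R2, Summable fun z : Z2 => γ z * Real.exp (dotR a (emb z))) (a v : R2) :
    Summable fun z : Z2 => γ z * Real.exp (dotR a (emb z)) * dotR v (emb z) := by
  refine Summable.of_norm_bounded ((hA3 (a + v)).add (hA3 (a + (-1 : ℝ) • v))) fun z => ?_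
  simp only [dotR_add_left, dotR_smul_left, Real.exp_add]
  rw [Real.norm_eq_abs, abs_mul, abs_of_nonneg (mul_nonneg (hγ0 z) (Real.exp_nonneg _)),
    ← mul_assoc, ← mul_assoc, ← mul_add]
  refine mul_le_mul_of_nonneg_left ?_ (mul_nonneg (hγ0 z) (Real.exp_nonneg _))
  have h1 := Real.add_one_le_exp (dotR v (emb z))
  have h2 := Real.add_one_le_exp (-1 * dotR v (emb z))
  have h3 := Real.exp_pos (dotR v (emb z))
  have h4 := Real.exp_pos (-1 * dotR v (emb z))
  rw [abs_le]
  constructor <;> linarith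

lemma hasSum_gradJgf (hγ0 : ∀ z, 0 ≤ γ z)
    (hA3 : ∀ a : R2, Summable fun z : Z2 => γ z * Real.exp (dotR a (emb z))) (a v : R2) :
    HasSum (fun z : Z2 => γ z * Real.exp (dotR a (emb z)) * dotR v (emb z))
      (dotR v (gradJgf γ a)) := by
  have h1 := (summable_mul_coord hγ0 hA3 a (1, 0)).hasSum
  have h2 := (summable_mul_coord hγ0 hA3 a (0, 1)).hasSum
  refine hasSum_of_eq ((h1.mul_left v.1).add (h2.mul_left v.2)) (fun z => ?_) ?_
  · simp only [dotR]; ring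
  · simp [dotR, emb, gradJgf]

lemma hasSum_linear_mul_exp (hγ0 : ∀ z, 0 ≤ γ z)
    (hA3 : ∀ a : R2, Summable fun z : Z2 => γ z * Real.exp (dotR a (emb z))) {a v : R2}
    (ha : jgf γ a = 1) (hv : dotR v (gradJgf γ a) = 0) (z : Z2) :
    HasSum (fun w => γ (w - z) * (dotR v (emb w) * Real.exp (dotR a (emb w))))
      (dotR v (emb z) * Real.exp (dotR a (emb z))) := by
  rw [hasSum_translate_iff]
  have h1 := (hasSum_gradJgf hγ0 hA3 a v).mul_right (Real.exp (dotR a (emb z)))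
  have h2 := (hasSum_jgf hA3 a).mul_right (dotR v (emb z) * Real.exp (dotR a (emb z)))
  rw [hv] at h1
  rw [ha] at h2
  refine hasSum_of_eq (h1.add h2) (fun x => ?_) (by ring)
  simp only [dotR_emb_add, Real.exp_add]
  ring

lemma exp_mul_le_quadratic {t : ℝ} (ht0 : 0 ≤ t) (ht1 : t ≤ 1) (y : ℝ) :
    Real.exp (t * y) ≤ 1 + t * y + t ^ 2 * (2 * (Real.exp (2 * y) + Real.exp (-2 * y))) := by
  have h1 : Real.exp (t * y) ≤ 1 + t * y + |t * y| ^ 2 * Real.exp |t * y| := by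
    have h := Complex.norm_exp_sub_sum_le_norm_mul_exp ((t * y : ℝ) : ℂ) 2
    have e : Complex.exp ((t * y : ℝ) : ℂ)
        - ∑ m ∈ Finset.range 2, ((t * y : ℝ) : ℂ) ^ m / m.factorial
        = ((Real.exp (t * y) - (1 + t * y) : ℝ) : ℂ) := by
      simp [Finset.sum_range_succ]
    rw [e, Complex.norm_real, Complex.norm_real, Real.norm_eq_abs, Real.norm_eq_abs] at h
    linarith [(abs_le.1 h).2]
  have h2 : |t * y| ≤ |y| := by
    rw [abs_mul, abs_of_nonneg ht0]
    exact mul_le_of_le_one_left (abs_nonneg _) ht1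
  have h3 : |y| ^ 2 ≤ 2 * Real.exp |y| := by
    have := Real.quadratic_le_exp_of_nonneg (abs_nonneg y)
    nlinarith [abs_nonneg y]
  have h4 : Real.exp (2 * |y|) ≤ Real.exp (2 * y) + Real.exp (-2 * y) := by
    rcases abs_cases y with h | h <;> rw [h.1]
    · linarith [Real.exp_pos (-2 * y)]
    · rw [show 2 * -y = -2 * y by ring]
      linarith [Real.exp_pos (2 * y)]
  have h5 : |t * y| ^ 2 * Real.exp |t * y| ≤ t ^ 2 * (2 * Real.exp (2 * |y|)) := by
    calc |t * y| ^ 2 * Real.exp |t * y| ≤ |t * y| ^ 2 * Real.exp |y| := by gcongr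
      _ = t ^ 2 * (|y| ^ 2 * Real.exp |y|) := by rw [abs_mul, abs_of_nonneg ht0]; ring
      _ ≤ t ^ 2 * (2 * Real.exp |y| * Real.exp |y|) := by gcongr
      _ = t ^ 2 * (2 * Real.exp (2 * |y|)) := by rw [two_mul |y|, Real.exp_add]; ring
  have h6 : t ^ 2 * (2 * Real.exp (2 * |y|))
      ≤ t ^ 2 * (2 * (Real.exp (2 * y) + Real.exp (-2 * y))) := by gcongr
  linarith

/-- The generating function drops below `1` along a direction of descent. -/
lemma exists_jgf_le_one (hγ0 : ∀ z, 0 ≤ γ z)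
    (hA3 : ∀ a : R2, Summable fun z : Z2 => γ z * Real.exp (dotR a (emb z))) {a v : R2}
    (ha : jgf γ a = 1) (hv : dotR v (gradJgf γ a) < 0) :
    ∃ t : ℝ, 0 < t ∧ jgf γ (a + t • v) ≤ 1 := by
  set μ := dotR v (gradJgf γ a)
  set C := 2 * (jgf γ (a + (2 : ℝ) • v) + jgf γ (a + (-2 : ℝ) • v)) with hC
  have hC0 : 0 ≤ C := by
    have : ∀ b, 0 ≤ jgf γ b := fun b => tsum_nonneg fun z => mul_nonneg (hγ0 z) (Real.exp_nonneg _)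
    have h1 := this (a + (2 : ℝ) • v)
    have h2 := this (a + (-2 : ℝ) • v)
    positivity
  have key : ∀ t : ℝ, 0 ≤ t → t ≤ 1 → jgf γ (a + t • v) ≤ 1 + t * μ + t ^ 2 * C := by
    intro t ht0 ht1
    have hs := ((hasSum_jgf hA3 a).add ((hasSum_gradJgf hγ0 hA3 a v).mul_left t)).add
      ((((hasSum_jgf hA3 (a + (2 : ℝ) • v)).add
        (hasSum_jgf hA3 (a + (-2 : ℝ) • v))).mul_left 2).mul_left (t ^ 2))
    rw [ha] at hs
    refine hasSum_le (fun z => ?_) (hasSum_jgf hA3 (a + t • v)) hs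
    have h := mul_le_mul_of_nonneg_left (exp_mul_le_quadratic ht0 ht1 (dotR v (emb z)))
      (mul_nonneg (hγ0 z) (Real.exp_nonneg (dotR a (emb z))))
    simp only [dotR_add_left, dotR_smul_left, Real.exp_add]
    linarith
  refine ⟨min 1 (-μ / (C + 1)), lt_min one_pos (div_pos (neg_pos.2 hv) (by linarith)), ?_⟩
  set t := min 1 (-μ / (C + 1))
  have ht0 : 0 < t := lt_min one_pos (div_pos (neg_pos.2 hv) (by linarith))
  have ht1 : t ≤ 1 := min_le_left _ _
  have ht2 : t * (C + 1) ≤ -μ := (le_div_iff₀ (by linarith)).1 (min_le_right _ _)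
  have := key t ht0.le ht1
  nlinarith

/-- Comparison of two exponential moments of a centred variable. -/
lemma exists_pos_mul_jgf_sub_one_le (hγ0 : ∀ z, 0 ≤ γ z)
    (hA3 : ∀ a : R2, Summable fun z : Z2 => γ z * Real.exp (dotR a (emb z))) {a v : R2}
    (ha : jgf γ a = 1) (hv : dotR v (gradJgf γ a) = 0) :
    ∃ η : ℝ, 0 < η ∧
      η * (jgf γ (a + (-2 : ℝ) • v) - 1) ≤ jgf γ (a + (-1 : ℝ) • v) - 1 := by
  have hs := ((hasSum_jgf hA3 (a + (-1 : ℝ) • v)).sub (hasSum_jgf hA3 a)).add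
    (hasSum_gradJgf hγ0 hA3 a v)
  rw [ha, hv, add_zero] at hs
  have e : ∀ z : Z2, γ z * Real.exp (dotR (a + (-1 : ℝ) • v) (emb z))
      - γ z * Real.exp (dotR a (emb z)) + γ z * Real.exp (dotR a (emb z)) * dotR v (emb z)
      = γ z * Real.exp (dotR a (emb z))
        * (Real.exp (-dotR v (emb z)) - (-dotR v (emb z) + 1)) := by
    intro z
    simp only [dotR_add_left, dotR_smul_left, Real.exp_add, neg_one_mul]
    ring
  simp only [e] at hs
  have hnn : ∀ z : Z2, 0 ≤ γ z * Real.exp (dotR a (emb z))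
        * (Real.exp (-dotR v (emb z)) - (-dotR v (emb z) + 1)) := fun z =>
    mul_nonneg (mul_nonneg (hγ0 z) (Real.exp_nonneg _))
      (sub_nonneg.2 (Real.add_one_le_exp _))
  have h0 : 0 ≤ jgf γ (a + (-1 : ℝ) • v) - 1 := hs.nonneg hnn
  rcases h0.eq_or_lt with h | h
  · rw [← h] at hs
    have hz := (hasSum_zero_iff_of_nonneg hnn).1 hs
    have h2 : jgf γ (a + (-2 : ℝ) • v) = 1 := by
      rw [← ha]
      refine tsum_congr fun z => ?_
      have hz' := congrFun hz z
      simp only [Pi.zero_apply, mul_eq_zero, Real.exp_ne_zero, or_false] at hz'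
      rcases hz' with h' | h'
      · simp [h']
      · have : dotR v (emb z) = 0 := by
          by_contra hne
          exact absurd h' (sub_pos.2 (Real.add_one_lt_exp (neg_ne_zero.2 hne))).ne'
        simp only [dotR_add_left, dotR_smul_left, this, mul_zero, add_zero]
    exact ⟨1, one_pos, by rw [h2, ← h]; simp⟩
  · refine ⟨(jgf γ (a + (-1 : ℝ) • v) - 1) / (|jgf γ (a + (-2 : ℝ) • v) - 1| + 1),
      by positivity, ?_⟩
    rw [div_mul_eq_mul_div, div_le_iff₀ (by positivity)]
    refine mul_le_mul_of_nonneg_left ?_ h.le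
    linarith [le_abs_self (jgf γ (a + (-2 : ℝ) • v) - 1)]

/-- A nonnegative function, superharmonic on a half-plane, dominating the undershoot of a centred
projection of the twisted walk. -/
lemma exists_superharmonic_undershoot (hγ0 : ∀ z, 0 ≤ γ z)
    (hA3 : ∀ a : R2, Summable fun z : Z2 => γ z * Real.exp (dotR a (emb z))) {a v : R2}
    (ha : jgf γ a = 1) (hv : dotR v (gradJgf γ a) = 0) :
    ∃ U : Z2 → ℝ, (∀ w, 0 ≤ U w) ∧
      (∀ z, 0 < dotR v (emb z) → ∃ s ≤ U z, HasSum (fun w => γ (w - z) * U w) s) ∧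
      ∀ w, dotR v (emb w) ≤ 0 → |dotR v (emb w)| * Real.exp (dotR a (emb w)) ≤ U w := by
  obtain ⟨η, hη, hηle⟩ := exists_pos_mul_jgf_sub_one_le hγ0 hA3 ha hv
  set B := 9 / (4 * η) + 1 with hB
  have hηB : η * B = 9 / 4 + η := by rw [hB]; field_simp
  have hB1 : 1 ≤ B := by rw [hB]; linarith [show 0 < 9 / (4 * η) by positivity]
  have hquad : ∀ y : ℝ, 3 * y ≤ B + η * y ^ 2 := by
    intro y
    have : 0 ≤ η * (B + η * y ^ 2 - 3 * y) := by nlinarith [sq_nonneg (η * y - 3 / 2)]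
    linarith [nonneg_of_mul_nonneg_right this hη]
  have hneg : ∀ x : ℝ, x ≤ 0 → |x| ≤ x + B - Real.exp (-1 * x) + η * Real.exp (-2 * x) := by
    intro x hx
    have h1 := Real.add_one_le_exp (-1 * x)
    have h2 := hquad (Real.exp (-1 * x))
    have h3 : Real.exp (-2 * x) = Real.exp (-1 * x) ^ 2 := by
      rw [← Real.exp_nat_mul]; congr 1; push_cast; ring
    rw [abs_of_nonpos hx, h3]
    linarith
  have eU : ∀ w, (dotR v (emb w) + B - Real.exp (-1 * dotR v (emb w))
      + η * Real.exp (-2 * dotR v (emb w))) * Real.exp (dotR a (emb w))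
      = dotR v (emb w) * Real.exp (dotR a (emb w)) + B * Real.exp (dotR a (emb w))
        - Real.exp (dotR (a + (-1 : ℝ) • v) (emb w))
        + η * Real.exp (dotR (a + (-2 : ℝ) • v) (emb w)) := by
    intro w
    simp only [dotR_add_left, dotR_smul_left, Real.exp_add]
    ring
  refine ⟨fun w => (dotR v (emb w) + B - Real.exp (-1 * dotR v (emb w))
    + η * Real.exp (-2 * dotR v (emb w))) * Real.exp (dotR a (emb w)), fun w => ?_,
    fun z hz => ?_, fun w hw => ?_⟩
  · refine mul_nonneg ?_ (Real.exp_nonneg _)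
    rcases le_or_gt (dotR v (emb w)) 0 with h | h
    · exact (abs_nonneg _).trans (hneg _ h)
    · have h1 : Real.exp (-1 * dotR v (emb w)) ≤ 1 := Real.exp_le_one_iff.2 (by linarith)
      have h2 : 0 ≤ η * Real.exp (-2 * dotR v (emb w)) := by positivity
      linarith
  · have hs := (((hasSum_linear_mul_exp hγ0 hA3 ha hv z).add
      ((hasSum_exp hA3 a z).mul_left B)).sub (hasSum_exp hA3 (a + (-1 : ℝ) • v) z)).add
      ((hasSum_exp hA3 (a + (-2 : ℝ) • v) z).mul_left η)
    refine ⟨_, ?_, hasSum_of_eq hs (fun w => by simp only [eU]; ring) rfl⟩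
    have h1 : η * (jgf γ (a + (-2 : ℝ) • v) - 1) * Real.exp (-2 * dotR v (emb z))
        ≤ (jgf γ (a + (-1 : ℝ) • v) - 1) * Real.exp (-1 * dotR v (emb z)) := by
      have hψ : 0 ≤ jgf γ (a + (-1 : ℝ) • v) - 1 := by
        have h := (hasSum_jgf hA3 a).sub (hasSum_gradJgf hγ0 hA3 a v)
        rw [ha, hv, sub_zero] at h
        refine sub_nonneg.2 (hasSum_le (fun w => ?_) h (hasSum_jgf hA3 (a + (-1 : ℝ) • v)))
        have h' := mul_le_mul_of_nonneg_left (Real.add_one_le_exp (-1 * dotR v (emb w)))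
          (mul_nonneg (hγ0 w) (Real.exp_nonneg (dotR a (emb w))))
        simp only [dotR_add_left, dotR_smul_left, Real.exp_add]
        linarith
      calc _ ≤ (jgf γ (a + (-1 : ℝ) • v) - 1) * Real.exp (-2 * dotR v (emb z)) := by gcongr
        _ ≤ _ := by
          refine mul_le_mul_of_nonneg_left (Real.exp_le_exp.2 (by linarith)) hψ
    have h2 := mul_le_mul_of_nonneg_right h1 (Real.exp_nonneg (dotR a (emb z)))
    simp only [ha, dotR_add_left, dotR_smul_left, Real.exp_add]
    linarith
  · exact mul_le_mul_of_nonneg_right (hneg _ hw) (Real.exp_nonneg _)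

/-- Exponentials tilted along a direction of descent provide nonnegative superharmonic functions. -/
lemma exists_superharmonic_exp (hγ0 : ∀ z, 0 ≤ γ z)
    (hA3 : ∀ a : R2, Summable fun z : Z2 => γ z * Real.exp (dotR a (emb z))) {a v : R2}
    (ha : jgf γ a = 1) (hv : dotR v (gradJgf γ a) < 0) :
    ∃ t : ℝ, 0 < t ∧ ∀ z, ∃ s ≤ Real.exp (t * dotR v (emb z)) * Real.exp (dotR a (emb z)),
      HasSum (fun w => γ (w - z) *
        (Real.exp (t * dotR v (emb w)) * Real.exp (dotR a (emb w)))) s := by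
  obtain ⟨t, ht, hle⟩ := exists_jgf_le_one hγ0 hA3 ha hv
  refine ⟨t, ht, fun z => ⟨_, ?_, hasSum_of_eq (hasSum_exp hA3 (a + t • v) z) (fun w => ?_) rfl⟩⟩
  · have := mul_le_mul_of_nonneg_right hle (Real.exp_nonneg (dotR (a + t • v) (emb z)))
    rw [one_mul] at this
    refine this.trans_eq ?_
    simp only [dotR_add_left, dotR_smul_left, Real.exp_add]
    ring
  · simp only [dotR_add_left, dotR_smul_left, Real.exp_add]
    ring

/-- Boundary case: the drift of the twisted walk is parallel to the side `v · x = 0` of the cone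
`{v · x > 0, u · x > 0}`. -/
lemma sub_exitExp_linear_pos_harmonic (hγ0 : ∀ z, 0 ≤ γ z)
    (hA3 : ∀ a : R2, Summable fun z : Z2 => γ z * Real.exp (dotR a (emb z))) {a u v : R2}
    (ha : jgf γ a = 1) (hv : dotR v (gradJgf γ a) = 0) (hu : 0 < dotR u (gradJgf γ a))
    (hA : ∀ z, z ∈ A ↔ 0 < dotR v (emb z) ∧ 0 < dotR u (emb z))
    (hirr : ∀ z z', z ∈ A → z' ∈ A → ∃ n, 0 < aliveP (twKer γ 0) A n z z')
    {g : Z2 → ℝ} (hgdef : g = fun w => dotR v (emb w) * Real.exp (dotR a (emb w)))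
    {z : Z2} (hz : z ∈ A) :
    exitLExp (twKer γ 0) A z (fun w => |g w|) ≠ ⊤ ∧
    0 < g z - exitExp (twKer γ 0) A z g ∧
    (∑' z', if z' ∈ A then γ (z' - z) * (g z' - exitExp (twKer γ 0) A z' g) else 0)
      = g z - exitExp (twKer γ 0) A z g := by
  obtain ⟨hp, hr⟩ := (hA z).1 hz
  set p := dotR v (emb z)
  set r := dotR u (emb z)
  set d : R2 := (r / p) • v + (-1 : ℝ) • u with hd
  have hdot : ∀ x, dotR d x = r / p * dotR v x - dotR u x := by
    intro x
    rw [hd, dotR_add_left, dotR_smul_left, dotR_smul_left]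
    ring
  obtain ⟨t, ht, hV⟩ := exists_superharmonic_exp hγ0 hA3 ha
    (v := d) (by rw [hdot, hv]; linarith)
  obtain ⟨U, hU0, hUsup, hUle⟩ := exists_superharmonic_undershoot hγ0 hA3 ha hv
  have hrp : 0 < r / p := div_pos hr hp
  set C := (t * (r / p))⁻¹ with hC
  have hC0 : 0 < C := by positivity
  set V : Z2 → ℝ := fun w =>
    C * (Real.exp (t * dotR d (emb w)) * Real.exp (dotR a (emb w))) with hVdef
  have hV0 : ∀ w, 0 ≤ V w := fun w => by positivity
  have hVsup : ∀ z, ∃ s ≤ V z, HasSum (fun w => γ (w - z) * V w) s := by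
    intro z
    obtain ⟨s, hs, hsum⟩ := hV z
    exact ⟨C * s, mul_le_mul_of_nonneg_left hs hC0.le,
      hasSum_of_eq (hsum.mul_left C) (fun w => by simp only [hVdef]; ring) rfl⟩
  have hVle : ∀ w, dotR u (emb w) ≤ 0 → dotR v (emb w) * Real.exp (dotR a (emb w)) ≤ V w := by
    intro w hw
    have h1 : t * (r / p) * dotR v (emb w) ≤ Real.exp (t * dotR d (emb w)) := by
      have h2 := Real.add_one_le_exp (t * dotR d (emb w))
      have h3 : t * dotR u (emb w) ≤ 0 := mul_nonpos_of_nonneg_of_nonpos ht.le hw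
      rw [hdot] at h2 ⊢
      linarith
    have h2 : dotR v (emb w) ≤ C * Real.exp (t * dotR d (emb w)) := by
      rw [hC, ← div_eq_inv_mul, le_div_iff₀ (by positivity)]
      linarith
    have h3 := mul_le_mul_of_nonneg_right h2 (Real.exp_nonneg (dotR a (emb w)))
    simp only [hVdef]
    linarith
  have hg : ∀ z, HasSum (fun w => γ (w - z) * g w) (g z) := by
    subst hgdef
    exact hasSum_linear_mul_exp hγ0 hA3 ha hv
  have hgA : ∀ z ∈ A, 0 ≤ g z := by
    subst hgdef
    intro z hz
    exact mul_nonneg ((hA z).1 hz).1.le (Real.exp_nonneg _)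
  have hgV : ∀ w ∉ A, g w ≤ V w := by
    subst hgdef
    intro w hw
    by_cases h : 0 < dotR v (emb w)
    · exact hVle w (not_lt.1 fun h' => hw ((hA w).2 ⟨h, h'⟩))
    · exact (mul_nonpos_of_nonpos_of_nonneg (not_lt.1 h) (Real.exp_nonneg _)).trans (hV0 w)
  have hfin : ∀ z, exitLExp (twKer γ 0) A z (fun w => |g w|) ≠ ⊤ := by
    intro z
    refine ne_top_of_le_ne_top ENNReal.ofReal_ne_top
      (exitLExp_le_of_superharmonic hγ0 (U := fun w => U w + V w)
        (fun w => add_nonneg (hU0 w) (hV0 w)) (fun z hz => ?_) (fun w hw => ?_) z)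
    · obtain ⟨s, hs, hsum⟩ := hUsup z ((hA z).1 hz).1
      obtain ⟨s', hs', hsum'⟩ := hVsup z
      exact ⟨s + s', add_le_add hs hs', by simpa only [mul_add] using hsum.add hsum'⟩
    · rcases le_or_gt (dotR v (emb w)) 0 with h | h
      · have := hUle w h
        rw [hgdef]
        simp only [abs_mul, Real.abs_exp]
        linarith [hV0 w]
      · have h1 : 0 ≤ g w := by rw [hgdef]; positivity
        rw [abs_of_nonneg h1]
        linarith [hgV w hw, hU0 w]
  obtain ⟨n, hn⟩ := exists_nat_gt (C / p)
  have hn' : C < n * p := (div_lt_iff₀ hp).1 hn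
  have hn0 : (0 : ℝ) < n := (div_pos hC0 hp).trans hn
  have hvn : dotR v (emb (n • z)) = n * p := by rw [emb_nsmul, dotR_smul_right]
  have hun : dotR u (emb (n • z)) = n * r := by rw [emb_nsmul, dotR_smul_right]
  have hdn : dotR d (emb (n • z)) = 0 := by
    rw [hdot, hvn, hun]
    field_simp
    ring
  have hmem : n • z ∈ A := (hA _).2 ⟨by rw [hvn]; positivity, by rw [hun]; positivity⟩
  refine ⟨hfin z, sub_exitExp_pos_harmonic hγ0 hirr hg hgA hfin hmem
    ((exitLExp_le_of_superharmonic hγ0 hV0 (fun z _ => hVsup z) hgV _).trans_lt ?_) hz⟩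
  have hgn : g (n • z) = n * p * Real.exp (dotR a (emb (n • z))) := by rw [hgdef, ← hvn]
  have hVn : V (n • z) = C * Real.exp (dotR a (emb (n • z))) := by
    simp only [hVdef, hdn, mul_zero, Real.exp_zero, one_mul]
  rw [ENNReal.ofReal_lt_ofReal_iff (by rw [hgn]; positivity), hgn, hVn]
  gcongr

/-- Interior case: the drift of the twisted walk points into the cone. -/
lemma sub_exitExp_exp_pos_harmonic (hγ0 : ∀ z, 0 ≤ γ z)
    (hA3 : ∀ a : R2, Summable fun z : Z2 => γ z * Real.exp (dotR a (emb z))) {a u v : R2}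
    (ha : jgf γ a = 1) (hv : 0 < dotR v (gradJgf γ a)) (hu : 0 < dotR u (gradJgf γ a))
    (hA : ∀ z, z ∈ A ↔ 0 < dotR v (emb z) ∧ 0 < dotR u (emb z))
    (hirr : ∀ z z', z ∈ A → z' ∈ A → ∃ n, 0 < aliveP (twKer γ 0) A n z z')
    {g : Z2 → ℝ} (hgdef : g = fun w => Real.exp (dotR a (emb w)))
    {z : Z2} (hz : z ∈ A) :
    exitLExp (twKer γ 0) A z g ≠ ⊤ ∧
    0 < g z - exitExp (twKer γ 0) A z g ∧
    (∑' z', if z' ∈ A then γ (z' - z) * (g z' - exitExp (twKer γ 0) A z' g) else 0)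
      = g z - exitExp (twKer γ 0) A z g := by
  obtain ⟨hp, hr⟩ := (hA z).1 hz
  have hneg : ∀ x y : R2, dotR ((-1 : ℝ) • x) y = -dotR x y := by
    intro x y
    rw [dotR_smul_left, neg_one_mul]
  obtain ⟨t, ht, hV⟩ := exists_superharmonic_exp hγ0 hA3 ha
    (v := (-1 : ℝ) • v) (by rw [hneg]; linarith)
  obtain ⟨s, hs, hU⟩ := exists_superharmonic_exp hγ0 hA3 ha
    (v := (-1 : ℝ) • u) (by rw [hneg]; linarith)
  simp only [hneg] at hV hU
  set W : Z2 → ℝ := fun w => Real.exp (t * -dotR v (emb w)) * Real.exp (dotR a (emb w))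
    + Real.exp (s * -dotR u (emb w)) * Real.exp (dotR a (emb w)) with hW
  have hgpos : ∀ w, 0 < g w := fun w => by rw [hgdef]; positivity
  have hg : ∀ z, HasSum (fun w => γ (w - z) * g w) (g z) := by
    subst hgdef
    intro z
    simpa only [ha, one_mul] using hasSum_exp hA3 a z
  have hgW : ∀ w ∉ A, g w ≤ W w := by
    intro w hw
    rw [hA, not_and_or, not_lt, not_lt] at hw
    have h1 := Real.exp_pos (t * -dotR v (emb w))
    have h2 := Real.exp_pos (s * -dotR u (emb w))
    have key : 1 ≤ Real.exp (t * -dotR v (emb w)) + Real.exp (s * -dotR u (emb w)) := by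
      rcases hw with hw | hw
      · have := Real.one_le_exp (mul_nonneg ht.le (neg_nonneg.2 hw))
        linarith
      · have := Real.one_le_exp (mul_nonneg hs.le (neg_nonneg.2 hw))
        linarith
    have := mul_le_mul_of_nonneg_right key (Real.exp_nonneg (dotR a (emb w)))
    simp only [hgdef, hW]
    linarith
  have hfin : ∀ z, exitLExp (twKer γ 0) A z g ≠ ⊤ := fun z =>
    ne_top_of_le_ne_top ENNReal.ofReal_ne_top (exitLExp_le_of_superharmonic hγ0
      (fun w => (hgpos w).le) (fun z _ => ⟨_, le_rfl, hg z⟩) (fun _ _ => le_rfl) z)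
  obtain ⟨n, hn⟩ := exists_nat_gt (max (1 / (t * dotR v (emb z))) (1 / (s * dotR u (emb z))))
  obtain ⟨hn1, hn2⟩ := max_lt_iff.1 hn
  have hn0 : (0 : ℝ) < n := (by positivity : 0 < 1 / (t * dotR v (emb z))).trans hn1
  rw [div_lt_iff₀ (by positivity)] at hn1 hn2
  have hvn : dotR v (emb (n • z)) = n * dotR v (emb z) := by rw [emb_nsmul, dotR_smul_right]
  have hun : dotR u (emb (n • z)) = n * dotR u (emb z) := by rw [emb_nsmul, dotR_smul_right]
  have hmem : n • z ∈ A := (hA _).2 ⟨by rw [hvn]; positivity, by rw [hun]; positivity⟩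
  have habs : (fun w => |g w|) = g := funext fun w => abs_of_pos (hgpos w)
  refine ⟨hfin z, sub_exitExp_pos_harmonic hγ0 hirr hg (fun z _ => (hgpos z).le)
    (by rwa [habs]) hmem
    ((exitLExp_le_of_superharmonic hγ0 (U := W) (fun w => by positivity) (fun z _ => ?_)
      hgW _).trans_lt ?_) hz⟩
  · obtain ⟨x, hx, hsum⟩ := hV z
    obtain ⟨y, hy, hsum'⟩ := hU z
    exact ⟨x + y, add_le_add hx hy, by simpa only [hW, mul_add] using hsum.add hsum'⟩
  · have half : ∀ x : ℝ, 1 < x → Real.exp (-x) < 1 / 2 := by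
      intro x hx
      rw [Real.exp_neg, ← one_div]
      exact one_div_lt_one_div_of_lt two_pos (by linarith [Real.add_one_le_exp x])
    have h1 : Real.exp (t * -dotR v (emb (n • z))) < 1 / 2 := by
      rw [mul_neg, hvn]
      exact half _ (by linarith)
    have h2 : Real.exp (s * -dotR u (emb (n • z))) < 1 / 2 := by
      rw [mul_neg, hun]
      exact half _ (by linarith)
    rw [ENNReal.ofReal_lt_ofReal_iff (hgpos _)]
    have h3 : Real.exp (t * -dotR v (emb (n • z))) + Real.exp (s * -dotR u (emb (n • z))) < 1 := by
      linarith
    have := mul_lt_mul_of_pos_right h3 (Real.exp_pos (dotR a (emb (n • z))))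
    simp only [hgdef, hW]
    linarith

end

/-- **Proposition 1.** For every `a ∈ Γ` and `z ∈ K`, the function
`h_a(z) = (z·fᵢ)e^{a·z} − 𝔼_z[(fᵢ·S(τ))e^{a·S(τ)}; τ < ∞]` if `q(a) = cᵢ` (`i = 1,2`), and
`h_a(z) = e^{a·z} − 𝔼_z[e^{a·S(τ)}; τ < ∞]` if `q(a)` lies in the interior of `Σ`
(equivalently `q(a) ∈ K`), is strictly positive on `K` and harmonic for the random walk
killed when leaving `K`, i.e. `𝔼_z[h_a(S(1)); τ > 1] = h_a(z)` for all `z ∈ K`. -/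
theorem harmonic_functions_of_killed_walk
    (γ : Z2 → ℝ) (c f : Fin 2 → R2) (K : Set R2)
    -- `γ` is a probability distribution on `ℤ²`
    (hγ0 : ∀ z : Z2, 0 ≤ γ z) (hγ1 : HasSum γ 1)
    -- `c 0, c 1` are unit vectors, `f i` is the unit vector perpendicular to `c i`
    -- pointing into the cone; the angle between `c 0` and `c 1` lies in `(0, π)`
    (hcUnit : ∀ i, nrm (c i) = 1) (hfUnit : ∀ i, nrm (f i) = 1)
    (hperp : ∀ i, dotR (f i) (c i) = 0)
    (hinward : ∀ i j, i ≠ j → 0 < dotR (f i) (c j))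
    -- `K` is the open convex cone bounded by the rays through `c 0` and `c 1`
    (hK : K = {x : R2 | ∀ i, 0 < dotR (f i) x})
    -- (A1) the walk is irreducible with nonzero mean
    (hA1 : ∀ z z' : Z2, ∃ n : ℕ, 0 < nstep (twKer γ 0) n z z')
    (hmean : (∑' z : Z2, γ z * (z.1 : ℝ), ∑' z : Z2, γ z * (z.2 : ℝ)) ≠ (0, 0))
    -- (A2) the walk killed when leaving `K` is irreducible in `K`
    (hA2 : ∀ z z' : Z2, emb z ∈ K → emb z' ∈ K →
        ∃ n : ℕ, 0 < aliveP (twKer γ 0) (emb ⁻¹' K) n z z')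
    -- (A3) the jump generating function is finite everywhere
    (hA3 : ∀ a : R2, Summable fun z : Z2 => γ z * Real.exp (dotR a (emb z)))
    -- (A4) the projections `fᵢ·S(n)` are aperiodic random walks
    (hA4 : ∀ i : Fin 2, ∀ d : ℕ,
        (∀ n : ℕ, 0 < n →
          0 < ∑' z : Z2, (if dotR (f i) (emb z) = 0 then nstep (twKer γ 0) n 0 z else 0) →
          d ∣ n) → d = 1)
    -- `a ∈ Γ`
    (a : R2) (haD : jgf γ a = 1) (haq : qmap γ a ∈ closure K) :
    -- case `q(a) = cᵢ`, `i = 1, 2`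
    (∀ i : Fin 2, qmap γ a = c i →
      ∀ h : Z2 → ℝ,
        h = (fun w => dotR (f i) (emb w) * Real.exp (dotR a (emb w))
              - exitExp (twKer γ 0) (emb ⁻¹' K) w
                  (fun z' => dotR (f i) (emb z') * Real.exp (dotR a (emb z')))) →
        ∀ z : Z2, emb z ∈ K →
          -- the defining expectation converges absolutely
          exitLExp (twKer γ 0) (emb ⁻¹' K) z
              (fun z' => |dotR (f i) (emb z')| * Real.exp (dotR a (emb z'))) ≠ ⊤ ∧
          -- strict positivity on `K`
          0 < h z ∧
          -- harmonicity for the killed walk: `𝔼_z[h(S(1)); τ > 1] = h(z)`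
          (∑' z' : Z2, if emb z' ∈ K then γ (z' - z) * h z' else 0) = h z) ∧
    -- case `q(a)` in the interior of `Σ`
    (qmap γ a ∈ K →
      ∀ h : Z2 → ℝ,
        h = (fun w => Real.exp (dotR a (emb w))
              - (exitLExp (twKer γ 0) (emb ⁻¹' K) w
                  (fun z' => Real.exp (dotR a (emb z')))).toReal) →
        ∀ z : Z2, emb z ∈ K →
          exitLExp (twKer γ 0) (emb ⁻¹' K) z
              (fun z' => Real.exp (dotR a (emb z'))) ≠ ⊤ ∧
          0 < h z ∧
          (∑' z' : Z2, if emb z' ∈ K then γ (z' - z) * h z' else 0) = h z) := by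
  have hmemA : ∀ i j : Fin 2, i ≠ j → ∀ z : Z2, z ∈ emb ⁻¹' K ↔
      0 < dotR (f i) (emb z) ∧ 0 < dotR (f j) (emb z) := by
    intro i j hij z
    rw [Set.mem_preimage, hK, Set.mem_ofPred_eq]
    refine ⟨fun h => ⟨h i, h j⟩, fun h k => ?_⟩
    rcases (by omega : k = i ∨ k = j) with rfl | rfl
    exacts [h.1, h.2]
  have hdotq : ∀ v : R2, dotR v (qmap γ a) = (nrm (gradJgf γ a))⁻¹ * dotR v (gradJgf γ a) :=
    fun v => dotR_smul_right _ _ _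
  have hinv : 0 ≤ (nrm (gradJgf γ a))⁻¹ := inv_nonneg.2 (Real.sqrt_nonneg _)
  have hirr : ∀ z z' : Z2, z ∈ emb ⁻¹' K → z' ∈ emb ⁻¹' K →
      ∃ n : ℕ, 0 < aliveP (twKer γ 0) (emb ⁻¹' K) n z z' := hA2
  constructor
  · rintro i hqi h rfl z hz
    obtain ⟨j, hij⟩ : ∃ j : Fin 2, i ≠ j := ⟨i + 1, by omega⟩
    have hu : 0 < dotR (f j) (gradJgf γ a) := by
      have := hinward j i hij.symm
      rw [← hqi, hdotq] at this
      exact pos_of_mul_pos_right this hinv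
    have hv : dotR (f i) (gradJgf γ a) = 0 := by
      have h1 := hperp i
      have h2 := hinward j i hij.symm
      rw [← hqi, hdotq] at h1 h2
      exact (mul_eq_zero.1 h1).resolve_left (left_ne_zero_of_mul h2.ne')
    have := sub_exitExp_linear_pos_harmonic hγ0 hA3 haD hv hu (hmemA i j hij) hirr rfl hz
    simpa only [abs_mul, Real.abs_exp, Set.mem_preimage] using this
  · rintro hq h rfl z hz
    have hpos : ∀ i, 0 < dotR (f i) (gradJgf γ a) := by
      intro i
      rw [hK] at hq
      have := hq i
      rw [hdotq] at this
      exact pos_of_mul_pos_right this hinv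
    have := sub_exitExp_exp_pos_harmonic hγ0 hA3 haD (hpos 0) (hpos 1)
      (hmemA 0 1 (by decide)) hirr rfl hz
    have hnegexp : ∀ w : Z2, exitLExp (twKer γ 0) (emb ⁻¹' K) w
        (fun z' => -Real.exp (dotR a (emb z'))) = 0 := by
      intro w
      simp [exitLExp, ENNReal.ofReal_of_nonpos, Real.exp_nonneg]
    simpa only [exitExp, hnegexp, ENNReal.toReal_zero, sub_zero, Set.mem_preimage] using this
end KilledRW
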